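/- arXiv:2505.10201 — 12 statements merged into one kernel-verified Lean document; each statement's English description precedes it below -/
import Mathlib

section
/- The abduction instance (KB, H, M) has an explanation (some set of literals over H) if and only if there exists a model σ of KB such that every model τ of KB that agrees with σ on H (i.e., τ(x) = σ(x) for all x ∈ H) assigns true to every variable of M. (This is the correctness of the enumeration-based algorithm for ABD(Γ), which partitions the models of KB into equivalence classes by their restriction to H.) -/
variable {V : Type*}

/-- An assignment `σ` satisfies a set of literals `E`; the literal `(x, true)`
is the positive literal `x` and `(x, false)` is the negative literal `¬x`. -/
def SatLits (σ : V → Bool) (E : Set (V × Bool)) : Prop :=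
  ∀ l ∈ E, σ l.1 = l.2

/-- `E` is an explanation for the abduction instance `(KB, H, M)`:
`E` is a set of literals over `H`, `KB ∧ E` is satisfiable, and `KB ∧ E ⊨ M`. -/
def IsExpl (KB : Set (V → Bool)) (H M : Set V) (E : Set (V × Bool)) : Prop :=
  (∀ l ∈ E, l.1 ∈ H) ∧ (∃ σ ∈ KB, SatLits σ E) ∧
    ∀ σ ∈ KB, SatLits σ E → ∀ m ∈ M, σ m = true

/-- `(KB, H, M)` has an explanation iff there is a model `σ` of `KB` such that
every model of `KB` agreeing with `σ` on `H` assigns true to every variable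
of `M`. -/
theorem stmt1 [Fintype V] (KB : Set (V → Bool)) (H M : Set V) :
    (∃ E, IsExpl KB H M E) ↔
      ∃ σ ∈ KB, ∀ τ ∈ KB, (∀ x ∈ H, τ x = σ x) → ∀ m ∈ M, τ m = true := by
  constructor
  · rintro ⟨E, hE, ⟨σ, hσ, hσE⟩, hM⟩
    exact ⟨σ, hσ, fun τ hτ hag => hM τ hτ fun l hl => (hag l.1 (hE l hl)).trans (hσE l hl)⟩
  · rintro ⟨σ, hσ, h⟩
    exact ⟨{l | l.1 ∈ H ∧ σ l.1 = l.2}, fun l hl => hl.1, ⟨σ, hσ, fun l hl => hl.2⟩,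
      fun τ hτ hτE => h τ hτ fun x hx => hτE (x, σ x) ⟨hx, rfl⟩⟩
end

section
/- Let E ⊆ H ⊆ V and suppose that for every F with E ⊊ F ⊆ H there is no model of KB assigning true to every variable of F. Let G be the set of literals consisting of x for each x ∈ E and ¬x for each x ∈ H ∖ E. If no model of KB satisfies every literal of G, then no model of KB assigns true to every variable of E (i.e., if KB ∧ G is unsatisfiable then KB ∧ E is unsatisfiable). (Claim 2 in the correctness proof of the polynomial-space O*(2^n) algorithm for P-ABD.) -/
variable {V : Type*}

/-- Claim 2 of the correctness proof of the polynomial-space `O*(2^n)`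
algorithm for positive abduction: if every strict superset `F` of `E` inside
`H` is inconsistent with `KB`, and `KB ∧ G` is unsatisfiable (where `G`
consists of the positive literals on `E` and the negative literals on
`H \ E`), then `KB ∧ E` is unsatisfiable. -/
theorem stmt2 [Fintype V] (KB : Set (V → Bool)) (H E : Set V)
    (hEH : E ⊆ H)
    (hmax : ∀ F : Set V, E ⊂ F → F ⊆ H → ¬∃ σ ∈ KB, ∀ x ∈ F, σ x = true)
    (hG : ¬∃ σ ∈ KB, SatLits σ
        ((fun x => (x, true)) '' E ∪ (fun x => (x, false)) '' (H \ E))) :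
    ¬∃ σ ∈ KB, ∀ x ∈ E, σ x = true := by
  rintro ⟨σ, hσ, hE⟩
  refine hG ⟨σ, hσ, ?_⟩
  rintro _ (⟨x, hx, rfl⟩ | ⟨x, ⟨hxH, hxE⟩, rfl⟩)
  · exact hE x hx
  · refine Bool.eq_false_iff.mpr fun hx => ?_
    refine hmax (insert x E) (Set.ssubset_insert hxE)
      (Set.insert_subset hxH hEH) ⟨σ, hσ, ?_⟩
    rintro y (rfl | hy)
    · exact hx
    · exact hE y hy
end

section
/- Let E ⊆ H ⊆ V and M ⊆ V, and suppose that for every F with E ⊊ F ⊆ H there is no model of KB assigning true to every variable of F. Let G be the set of literals consisting of x for each x ∈ E and ¬x for each x ∈ H ∖ E. If every model of KB satisfying every literal of G assigns true to every variable of M, then every model of KB assigning true to every variable of E assigns true to every variable of M (i.e., if KB ∧ G ∧ ¬M is unsatisfiable then KB ∧ E ∧ ¬M is unsatisfiable). (Claim 1 in the correctness proof of the polynomial-space O*(2^n) algorithm for P-ABD.) -/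
variable {V : Type*}

/-- Claim 1 of the correctness proof of the polynomial-space `O*(2^n)`
algorithm for positive abduction: if every strict superset `F` of `E` inside
`H` is inconsistent with `KB`, and `KB ∧ G ⊨ M` (where `G` consists of the
positive literals on `E` and the negative literals on `H \ E`), then
`KB ∧ E ⊨ M`. -/
theorem stmt3 [Fintype V] (KB : Set (V → Bool)) (H M E : Set V)
    (hEH : E ⊆ H)
    (hmax : ∀ F : Set V, E ⊂ F → F ⊆ H → ¬∃ σ ∈ KB, ∀ x ∈ F, σ x = true)
    (hG : ∀ σ ∈ KB, SatLits σ
        ((fun x => (x, true)) '' E ∪ (fun x => (x, false)) '' (H \ E)) →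
        ∀ m ∈ M, σ m = true) :
    ∀ σ ∈ KB, (∀ x ∈ E, σ x = true) → ∀ m ∈ M, σ m = true := by
  intro σ hσ hE
  refine hG σ hσ ?_
  rintro _ (⟨x, hx, rfl⟩ | ⟨x, hx, rfl⟩)
  · exact hE x hx
  · by_contra hne
    refine hmax (insert x E) (Set.ssubset_insert hx.2)
      (Set.insert_subset hx.1 hEH) ⟨σ, hσ, ?_⟩
    rintro y (rfl | hy)
    · simpa using hne
    · exact hE y hy
end

section
/- (a) For all integers k ≥ 1, 2 ≤ p ≤ k + 1 and every integer q, the relation R_{k,p,q} is a nonempty proper subset of (Fin k → Bool) (so every relation of Equations is non-trivial). (b) Equations is closed under substitution of constants: for every X ⊆ Fin k with j = |X| < k and every f : X → Bool, the (k − j)-ary relation obtained from R_{k,p,q} by fixing the coordinates in X according to f and projecting them away equals R_{k−j, p, q−c}, where c is the number of coordinates i ∈ X with f(i) = true. -/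
/-- The substitution of `f : X → Bool` in a `k`-ary Boolean relation `R`:
keep the tuples of `R` agreeing with `f` on the coordinates in `X` and
project away the coordinates in `X`. -/
def substRel {k : ℕ} (R : Set (Fin k → Bool)) (X : Finset (Fin k))
    (f : {i // i ∈ X} → Bool) : Set (Fin (k - X.card) → Bool) :=
  {y | (fun i : Fin k =>
      if h : i ∈ X then f ⟨i, h⟩
      else y ((Xᶜ.orderIsoOfFin
          (by rw [Finset.card_compl, Fintype.card_fin])).symm
          ⟨i, Finset.mem_compl.mpr h⟩)) ∈ R}

/-- The relation `R_{k,p,q}` defined by the equation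
`x₁ + ⋯ + x_k ≡ q (mod p)`: the set of `k`-tuples whose number of true
coordinates is congruent to `q` modulo `p`. -/
def EqRel (k p : ℕ) (q : ℤ) : Set (Fin k → Bool) :=
  {t | ((Finset.univ.filter fun i => t i = true).card : ZMod p) = (q : ZMod p)}

/-- The `k`-tuple whose first `n` coordinates are true lies in `R_{k,p,q}` when `n ≡ q (mod p)`. -/
theorem decide_lt_mem_EqRel {k p n : ℕ} {q : ℤ} (hn : n ≤ k) (h : (n : ZMod p) = (q : ZMod p)) :
    (fun i : Fin k => decide (i.val < n)) ∈ EqRel k p q := by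
  simpa [EqRel, Fin.card_filter_val_lt, hn] using h

theorem EqRel_nonempty {k p : ℕ} (hp : 1 ≤ p) (hpk : p ≤ k + 1) (q : ℤ) :
    (EqRel k p q).Nonempty := by
  have : NeZero p := ⟨by omega⟩
  have hlt := ZMod.val_lt (q : ZMod p)
  exact ⟨_, decide_lt_mem_EqRel (n := (q : ZMod p).val) (by omega) (ZMod.natCast_zmod_val _)⟩

theorem EqRel_ne_univ {k p : ℕ} (hp : 2 ≤ p) (hpk : p ≤ k + 1) (q : ℤ) :
    EqRel k p q ≠ Set.univ := by
  intro huniv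
  have : Fact (1 < p) := ⟨hp⟩
  obtain ⟨t, ht⟩ := EqRel_nonempty (by omega : 1 ≤ p) hpk (q + 1)
  have ht' : t ∈ EqRel k p q := huniv ▸ Set.mem_univ t
  simp only [EqRel, Set.mem_ofPred_eq] at ht ht'
  rw [ht'] at ht
  simp at ht

/-- The number of true coordinates of a tuple glued from `f` on `X` and from `y` on the complement
of `X` is the sum of the numbers of true coordinates of `f` and `y`. -/
theorem card_filter_dite_mem {α β : Type*} [Fintype α] [DecidableEq α] [Fintype β]
    (X : Finset α) (f : {i // i ∈ X} → Bool) (y : β → Bool) (e : {i // i ∈ Xᶜ} ≃ β) :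
    (Finset.univ.filter fun i : α =>
      (if h : i ∈ X then f ⟨i, h⟩ else y (e ⟨i, Finset.mem_compl.mpr h⟩)) = true).card =
      (Finset.univ.filter fun i : {i // i ∈ X} => f i = true).card +
        (Finset.univ.filter fun j : β => y j = true).card := by
  simp only [Finset.card_filter]
  rw [← Finset.sum_add_sum_compl X, ← Finset.sum_coe_sort X, ← Finset.sum_coe_sort Xᶜ,
    ← Equiv.sum_comp e]
  congr 1
  · exact Finset.sum_congr rfl fun i _ => by simp [i.2]
  · exact Finset.sum_congr rfl fun i _ => by simp [Finset.mem_compl.mp i.2]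

theorem substRel_EqRel {k : ℕ} (p : ℕ) (q : ℤ) (X : Finset (Fin k)) (f : {i // i ∈ X} → Bool) :
    substRel (EqRel k p q) X f =
      EqRel (k - X.card) p
        (q - ((Finset.univ.filter fun i : {i // i ∈ X} => f i = true).card : ℤ)) := by
  ext y
  have hcard := card_filter_dite_mem X f y
    (Xᶜ.orderIsoOfFin (by rw [Finset.card_compl, Fintype.card_fin])).symm.toEquiv
  simp only [substRel, EqRel, Set.mem_ofPred_eq]
  erw [hcard]
  push_cast
  rw [eq_sub_iff_add_eq, add_comm]

/-- (a) For `k ≥ 1`, `2 ≤ p ≤ k + 1` and any integer `q`, the relation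
`R_{k,p,q}` is a nonempty proper subset of all `k`-tuples (non-triviality of
the relations of `Equations`).
(b) `Equations` is closed under substitution of constants: fixing the
coordinates in `X` (with `|X| < k`) according to `f` and projecting them away
turns `R_{k,p,q}` into `R_{k−|X|, p, q−c}` where `c` is the number of
coordinates of `X` set to true by `f`. -/
theorem stmt6 :
    (∀ (k p : ℕ) (q : ℤ), 1 ≤ k → 2 ≤ p → p ≤ k + 1 →
      (EqRel k p q).Nonempty ∧ EqRel k p q ≠ Set.univ) ∧
    (∀ (k p : ℕ) (q : ℤ) (X : Finset (Fin k)) (f : {i // i ∈ X} → Bool),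
      1 ≤ k → 2 ≤ p → p ≤ k + 1 → X.card < k →
      substRel (EqRel k p q) X f =
        EqRel (k - X.card) p
          (q - ((Finset.univ.filter fun i : {i // i ∈ X} => f i = true).card : ℤ))) := by
  exact ⟨fun k p q _ hp hpk => ⟨EqRel_nonempty (by omega) hpk q, EqRel_ne_univ hp hpk q⟩,
    fun k p q X f _ _ _ _ => substRel_EqRel p q X f⟩
end

section
/- Let φ be an XSAT formula over a finite variable set V with |V| = n, and assume every variable of V belongs to the variable set S of at least one constraint of φ. Then the number of models of φ is at most 3^{n/3}; in particular it is at most c^n for the constant c = 3^{1/3} < 2, so the solution sets of XSAT instances are sparse. -/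
/-- An XSAT formula is a finite set of constraints, each a finite set `S` of
variables with a type: `true` means 'exactly-one', `false` means 'all-zero'.
`σ` is a model if every exactly-one constraint has exactly one true variable
and every all-zero constraint has all its variables false. -/
def XModel {V : Type*} [DecidableEq V] (φ : Finset (Finset V × Bool))
    (σ : V → Bool) : Prop :=
  ∀ c ∈ φ, (c.2 = true → (c.1.filter fun x => σ x = true).card = 1) ∧
    (c.2 = false → ∀ x ∈ c.1, σ x = false)

theorem Nat.cube_le_three_pow (k : ℕ) : k ^ 3 ≤ 3 ^ k := by
  rcases lt_or_ge k 3 with h | h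
  · interval_cases k <;> norm_num
  · induction k, h using Nat.le_induction with
    | base => norm_num
    | succ k hk ih =>
      have : (k + 1) ^ 3 ≤ 3 * k ^ 3 := by
        obtain ⟨m, rfl⟩ := Nat.exists_eq_add_of_le hk
        ring_nf
        nlinarith [Nat.zero_le m, Nat.zero_le (m ^ 2), Nat.zero_le (m ^ 3)]
      rw [pow_succ 3 k]
      omega

open Classical in
/-- The independent dominating subsets of `A` for a reflexive relation `R`, i.e. the maximal
independent sets of the graph induced on `A`. -/
noncomputable def maxIndepSets {V : Type*} (R : V → V → Prop) (A : Finset V) :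
    Finset (Finset V) :=
  A.powerset.filter fun T =>
    (∀ x ∈ T, ∀ y ∈ T, R x y → x = y) ∧ ∀ x ∈ A, ∃ y ∈ T, R x y

theorem mem_maxIndepSets {V : Type*} {R : V → V → Prop} {A T : Finset V} :
    T ∈ maxIndepSets R A ↔
      T ⊆ A ∧ (∀ x ∈ T, ∀ y ∈ T, R x y → x = y) ∧ ∀ x ∈ A, ∃ y ∈ T, R x y := by
  simp [maxIndepSets]

open Classical in
theorem maxIndepSets_subset_biUnion {V : Type*} {R : V → V → Prop} (hsymm : ∀ x y, R x y → R y x)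
    {A : Finset V} {x : V} (hx : x ∈ A) :
    maxIndepSets R A ⊆ (A.filter (R x)).biUnion fun y =>
      (maxIndepSets R (A \ A.filter (R y))).image (insert y) := by
  intro T hT
  obtain ⟨hTA, hind, hdom⟩ := mem_maxIndepSets.1 hT
  obtain ⟨y, hyT, hxy⟩ := hdom x hx
  refine Finset.mem_biUnion.2 ⟨y, Finset.mem_filter.2 ⟨hTA hyT, hxy⟩,
    Finset.mem_image.2 ⟨T.erase y, mem_maxIndepSets.2 ⟨?_, ?_, ?_⟩, Finset.insert_erase hyT⟩⟩
  · intro z hz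
    obtain ⟨hzy, hzT⟩ := Finset.mem_erase.1 hz
    simp only [Finset.mem_sdiff, Finset.mem_filter, not_and]
    exact ⟨hTA hzT, fun _ hyz => hzy (hind y hyT z hzT hyz).symm⟩
  · intro a ha b hb
    exact hind a (Finset.mem_of_mem_erase ha) b (Finset.mem_of_mem_erase hb)
  · intro z hz
    simp only [Finset.mem_sdiff, Finset.mem_filter, not_and] at hz
    obtain ⟨w, hwT, hzw⟩ := hdom z hz.1
    refine ⟨w, Finset.mem_erase.2 ⟨?_, hwT⟩, hzw⟩
    rintro rfl
    exact hz.2 hz.1 (hsymm _ _ hzw)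

open Classical in
/-- The Moon–Moser bound on the number of maximal independent sets. -/
theorem card_maxIndepSets_pow_three_le {V : Type*} {R : V → V → Prop} (hrefl : ∀ x, R x x)
    (hsymm : ∀ x y, R x y → R y x) (A : Finset V) :
    (maxIndepSets R A).card ^ 3 ≤ 3 ^ A.card := by
  induction A using Finset.strongInduction with
  | H A ih =>
    rcases A.eq_empty_or_nonempty with rfl | hA
    · have : (maxIndepSets R (∅ : Finset V)).card ≤ 1 := by
        simpa [maxIndepSets] using Finset.card_filter_le ({∅} : Finset (Finset V)) _
      simpa using Nat.pow_le_pow_left this 3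
    obtain ⟨x, hx, hmin⟩ := Finset.exists_min_image A (fun x => (A.filter (R x)).card) hA
    let f := fun y => (maxIndepSets R (A \ A.filter (R y))).card
    obtain ⟨y, hy, hmax⟩ := Finset.exists_max_image (A.filter (R x)) f
      ⟨x, Finset.mem_filter.2 ⟨hx, hrefl x⟩⟩
    have hyA : y ∈ A := (Finset.mem_filter.1 hy).1
    have hcard : (maxIndepSets R A).card ≤ (A.filter (R x)).card * f y :=
      calc (maxIndepSets R A).card
          ≤ _ := Finset.card_le_card (maxIndepSets_subset_biUnion hsymm hx)
        _ ≤ _ := Finset.card_biUnion_le_card_mul _ _ (f y) fun z hz =>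
            Finset.card_image_le.trans (hmax z hz)
    have hss : A \ A.filter (R y) ⊂ A :=
      Finset.sdiff_ssubset (Finset.filter_subset _ _) ⟨y, Finset.mem_filter.2 ⟨hyA, hrefl y⟩⟩
    have hle : (A.filter (R x)).card + (A \ A.filter (R y)).card ≤ A.card := by
      have h1 := Finset.card_sdiff_add_card_eq_card (Finset.filter_subset (R y) A)
      have h2 := hmin y hyA
      omega
    calc (maxIndepSets R A).card ^ 3
        ≤ ((A.filter (R x)).card * f y) ^ 3 := Nat.pow_le_pow_left hcard 3
      _ = (A.filter (R x)).card ^ 3 * f y ^ 3 := mul_pow _ _ _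
      _ ≤ 3 ^ (A.filter (R x)).card * 3 ^ (A \ A.filter (R y)).card :=
          Nat.mul_le_mul (Nat.cube_le_three_pow _) (ih _ hss)
      _ = 3 ^ ((A.filter (R x)).card + (A \ A.filter (R y)).card) := (pow_add _ _ _).symm
      _ ≤ 3 ^ A.card := Nat.pow_le_pow_right (by norm_num) hle

open Classical in
/-- The set of true variables of a model is a maximal independent set of the graph joining
variables that share a constraint, on the variables lying in no all-zero constraint. -/
theorem XModel.filter_mem_maxIndepSets {V : Type*} [Fintype V] [DecidableEq V]
    {φ : Finset (Finset V × Bool)} (hcover : ∀ x : V, ∃ c ∈ φ, x ∈ c.1) {σ : V → Bool}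
    (hσ : XModel φ σ) :
    Finset.univ.filter (fun x => σ x = true) ∈
      maxIndepSets (fun x y => ∃ c ∈ φ, x ∈ c.1 ∧ y ∈ c.1)
        (Finset.univ.filter fun x => ∀ c ∈ φ, x ∈ c.1 → c.2 = true) := by
  refine mem_maxIndepSets.2 ⟨?_, ?_, ?_⟩
  · intro x hx
    simp only [Finset.mem_filter, Finset.mem_univ, true_and] at hx ⊢
    intro c hc hxc
    by_contra h
    simp [(hσ c hc).2 (by simpa using h) x hxc] at hx
  · simp only [Finset.mem_filter, Finset.mem_univ, true_and]
    rintro x hx y hy ⟨c, hc, hxc, hyc⟩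
    cases hb : c.2 with
    | false => simp [(hσ c hc).2 hb x hxc] at hx
    | true =>
      exact Finset.card_le_one.1 ((hσ c hc).1 hb).le x (Finset.mem_filter.2 ⟨hxc, hx⟩)
        y (Finset.mem_filter.2 ⟨hyc, hy⟩)
  · simp only [Finset.mem_filter, Finset.mem_univ, true_and]
    intro x hx
    obtain ⟨c, hc, hxc⟩ := hcover x
    have h1 := (hσ c hc).1 (hx c hc hxc)
    obtain ⟨y, hy⟩ := Finset.card_pos.1 (h1 ▸ Nat.one_pos)
    obtain ⟨hyc, hy⟩ := Finset.mem_filter.1 hy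
    exact ⟨y, hy, c, hc, hxc, hyc⟩

/-- If every variable of `V` occurs in some constraint of the XSAT formula
`φ`, then `φ` has at most `3^{n/3}` models (`n = |V|`); in particular the
solution sets of XSAT instances are sparse, with `c = 3^{1/3} < 2`. -/
theorem stmt7 (V : Type*) [Fintype V] [DecidableEq V]
    (φ : Finset (Finset V × Bool))
    (hcover : ∀ x : V, ∃ c ∈ φ, x ∈ c.1) :
    (({σ : V → Bool | XModel φ σ}).ncard : ℝ)
      ≤ (3 : ℝ) ^ ((Fintype.card V : ℝ) / 3) := by
  classical
  set R : V → V → Prop := fun x y => ∃ c ∈ φ, x ∈ c.1 ∧ y ∈ c.1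
  set A : Finset V := Finset.univ.filter fun x => ∀ c ∈ φ, x ∈ c.1 → c.2 = true
  have hcard : ({σ : V → Bool | XModel φ σ}).ncard ≤ (maxIndepSets R A).card := by
    rw [← Set.ncard_coe_finset]
    refine Set.ncard_le_ncard_of_injOn (fun σ => Finset.univ.filter fun x => σ x = true)
      (fun σ hσ => ?_) (fun σ _ τ _ h => ?_) (Finset.finite_toSet _)
    · have hσ : XModel φ σ := hσ
      exact Finset.mem_coe.2 (by convert hσ.filter_mem_maxIndepSets hcover)
    · funext x
      have := Finset.ext_iff.1 h x
      simp only [Finset.mem_filter, Finset.mem_univ, true_and] at this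
      exact Bool.eq_iff_iff.2 this
  have hpow : ({σ : V → Bool | XModel φ σ}).ncard ^ 3 ≤ 3 ^ Fintype.card V :=
    calc _ ≤ (maxIndepSets R A).card ^ 3 := Nat.pow_le_pow_left hcard 3
      _ ≤ 3 ^ A.card := card_maxIndepSets_pow_three_le
          (fun x => let ⟨c, hc, hx⟩ := hcover x; ⟨c, hc, hx, hx⟩)
          (fun x y ⟨c, hc, hx, hy⟩ => ⟨c, hc, hy, hx⟩) A
      _ ≤ 3 ^ Fintype.card V := Nat.pow_le_pow_right (by norm_num) (Finset.card_le_univ A)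
  refine le_of_pow_le_pow_left₀ (n := 3) (by norm_num) (by positivity) ?_
  rw [← Real.rpow_mul_natCast (by norm_num), Nat.cast_ofNat, div_mul_cancel₀ _ (by norm_num),
    Real.rpow_natCast]
  exact_mod_cast hpow
end

section
/- Let k ≥ 1, let A be an m × n matrix over 𝔽₂ and b ∈ 𝔽₂^m. If every row of A has support of size at most k, and every column index j ∈ {1,…,n} belongs to the support of at least one row, then the number of solutions x ∈ 𝔽₂^n of A·x = b is at most 2^{(1 − 1/k)·n}. -/
/-- If every row of `A` has at most `k` nonzero entries and no column of `A` vanishes, then the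
number of columns is at most `k * A.rank`. -/
theorem Matrix.card_le_mul_rank_of_card_support_le {K ι κ : Type*} [Field K] [DecidableEq K]
    [Fintype ι] [Fintype κ] (A : Matrix ι κ K) (k : ℕ)
    (hrow : ∀ i, (Finset.univ.filter fun j => A i j ≠ 0).card ≤ k)
    (hcol : ∀ j, ∃ i, A i j ≠ 0) : Fintype.card κ ≤ k * A.rank := by
  classical
  obtain ⟨σ, a, ha, hspan, hli⟩ := exists_linearIndependent' K A.row
  have : Finite σ := Finite.of_injective a ha
  have := Fintype.ofFinite σ
  have hcard : Fintype.card σ = A.rank := by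
    rw [A.rank_eq_finrank_span_row, ← hspan, finrank_span_eq_card hli]
  have hcover : (Finset.univ : Finset κ) ⊆
      Finset.univ.biUnion fun s : σ => Finset.univ.filter fun j => A (a s) j ≠ 0 := by
    intro j _
    by_contra hj
    simp only [Finset.mem_biUnion, Finset.mem_univ, Finset.mem_filter, true_and, not_exists,
      not_not] at hj
    obtain ⟨i, hi⟩ := hcol j
    have hle : Submodule.span K (Set.range (A.row ∘ a)) ≤
        LinearMap.ker (LinearMap.proj j : (κ → K) →ₗ[K] K) := by
      rw [Submodule.span_le]
      rintro _ ⟨s, rfl⟩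
      exact hj s
    exact hi (hle (hspan ▸ Submodule.subset_span ⟨i, rfl⟩))
  calc Fintype.card κ ≤ _ := Finset.card_le_card hcover
    _ ≤ Fintype.card σ * k := Finset.card_biUnion_le_card_mul _ _ _ fun s _ => hrow (a s)
    _ = k * A.rank := by rw [hcard, mul_comm]

/-- A linear system `A *ᵥ x = b` over a finite field `K` in the unknowns `κ` has at most
`(card K) ^ (card κ - A.rank)` solutions. -/
theorem Matrix.ncard_mulVec_eq_le {K ι κ : Type*} [Field K] [Fintype K]
    [Fintype κ] (A : Matrix ι κ K) (b : ι → K) :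
    {x : κ → K | A.mulVec x = b}.ncard ≤ Fintype.card K ^ (Fintype.card κ - A.rank) := by
  rcases Set.eq_empty_or_nonempty {x : κ → K | A.mulVec x = b} with h | ⟨y, hy⟩
  · simp [h]
  have hker : Module.finrank K (LinearMap.ker A.mulVecLin) = Fintype.card κ - A.rank := by
    have h := A.mulVecLin.finrank_range_add_finrank_ker
    rw [Module.finrank_fintype_fun_eq_card] at h
    simp only [Matrix.rank]
    omega
  rw [← hker, ← Nat.card_eq_fintype_card, ← Module.natCard_eq_pow_finrank,
    ← SetLike.coe_sort_coe, Nat.card_coe_set_eq]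
  refine Set.ncard_le_ncard_of_injOn (fun x => x - y) (fun x hx => ?_)
    (fun x _ z _ h => sub_left_injective h) (Set.toFinite _)
  simp only [Set.mem_ofPred_eq] at hx hy
  simp [Matrix.mulVec_sub, hx, hy]

/-- Let `A` be an `m × n` matrix over `𝔽₂` and `b ∈ 𝔽₂^m`.  If every row of
`A` has support of size at most `k` (with `k ≥ 1`) and every column index
belongs to the support of some row, then the number of solutions of
`A·x = b` is at most `2^{(1 − 1/k)·n}`. -/
theorem stmt8 (k m n : ℕ) (hk : 1 ≤ k)
    (A : Matrix (Fin m) (Fin n) (ZMod 2)) (b : Fin m → ZMod 2)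
    (hrow : ∀ i, (Finset.univ.filter fun j => A i j ≠ 0).card ≤ k)
    (hcol : ∀ j, ∃ i, A i j ≠ 0) :
    (({x : Fin n → ZMod 2 | A.mulVec x = b}).ncard : ℝ)
      ≤ (2 : ℝ) ^ ((1 - 1 / (k : ℝ)) * (n : ℝ)) := by
  have hrank := A.card_le_mul_rank_of_card_support_le k hrow hcol
  have hle := A.ncard_mulVec_eq_le b
  have hwidth := A.rank_le_width
  rw [Fintype.card_fin] at hrank
  rw [Fintype.card_fin, ZMod.card] at hle
  have hk' : (0 : ℝ) < k := by exact_mod_cast hk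
  have hrank' : (n : ℝ) / k ≤ A.rank := by
    rw [div_le_iff₀' hk']
    exact_mod_cast hrank
  calc (({x : Fin n → ZMod 2 | A.mulVec x = b}).ncard : ℝ)
      ≤ (2 : ℝ) ^ (n - A.rank) := by exact_mod_cast hle
    _ = (2 : ℝ) ^ ((n : ℝ) - A.rank) := by
      rw [← Real.rpow_natCast, Nat.cast_sub hwidth]
    _ ≤ (2 : ℝ) ^ ((1 - 1 / (k : ℝ)) * (n : ℝ)) := by
      apply Real.rpow_le_rpow_of_exponent_le one_le_two
      rw [sub_mul, one_mul, one_div_mul_eq_div]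
      linarith
end

section
/- Suppose KB is given by a finite set 𝒞 of positive clauses and H ∩ M = ∅. Then (KB, H, M) has an explanation (some set of literals over H) if and only if it has a purely negative explanation, i.e., an explanation all of whose literals are negative. -/
variable {V : Type*}

/-- If the set of models `KB` is upward closed, dropping the positive literals of an
explanation yields an explanation, provided no hypothesis is a manifestation. -/
theorem IsExpl.negative_part {KB : Set (V → Bool)} (hKB : IsUpperSet KB) {H M : Set V}
    (hHM : Disjoint H M) {E : Set (V × Bool)} (hE : IsExpl KB H M E) :
    IsExpl KB H M {l ∈ E | l.2 = false} := by
  classical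
  obtain ⟨hEH, ⟨σ, hσ, hσE⟩, hent⟩ := hE
  refine ⟨fun l hl => hEH l hl.1, ⟨σ, hσ, fun l hl => hσE l hl.1⟩, fun τ hτ hτE m hm => ?_⟩
  have hle : τ ≤ fun x => if (x, true) ∈ E then true else τ x := by
    intro x
    dsimp only
    split_ifs
    · exact Bool.le_true _
    · exact le_rfl
  have hsat : SatLits (fun x => if (x, true) ∈ E then true else τ x) E := by
    rintro ⟨x, b⟩ hx
    cases b with
    | true => exact if_pos hx
    | false =>
      have hpos : (x, true) ∉ E := fun h =>
        Bool.false_ne_true ((hσE _ hx).symm.trans (hσE _ h))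
      exact (if_neg hpos).trans (hτE _ ⟨hx, rfl⟩)
  have hmE : (m, true) ∉ E := fun h => hHM.notMem_of_mem_left (hEH _ h) hm
  exact (if_neg hmE).symm.trans (hent _ (hKB hle hτ) hsat m hm)

/-- The models of a set of positive clauses form an upward closed set. -/
theorem isUpperSet_models_positive_clauses (𝒞 : Finset (Finset V)) :
    IsUpperSet {σ : V → Bool | ∀ C ∈ 𝒞, ∃ x ∈ C, σ x = true} := by
  intro σ τ hle hσ C hC
  obtain ⟨x, hx, hσx⟩ := hσ C hC
  exact ⟨x, hx, hle x hσx⟩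

/-- If `KB` is given by a finite set `𝒞` of positive clauses (each clause a
finite set of variables, satisfied if some member is true) and `H ∩ M = ∅`,
then `(KB, H, M)` has an explanation iff it has a purely negative
explanation. -/
theorem stmt10 [Fintype V] [DecidableEq V] (𝒞 : Finset (Finset V))
    (H M : Set V) (hHM : H ∩ M = ∅) :
    (∃ E, IsExpl {σ : V → Bool | ∀ C ∈ 𝒞, ∃ x ∈ C, σ x = true} H M E) ↔
      ∃ E, IsExpl {σ : V → Bool | ∀ C ∈ 𝒞, ∃ x ∈ C, σ x = true} H M E ∧
        ∀ l ∈ E, l.2 = false := by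
  constructor
  · rintro ⟨E, hE⟩
    exact ⟨_, hE.negative_part (isUpperSet_models_positive_clauses 𝒞)
      (Set.disjoint_iff_inter_eq_empty.mpr hHM), fun l hl => hl.2⟩
  · rintro ⟨E, hE, -⟩
    exact ⟨E, hE⟩
end

section
/- Suppose KB is given by a finite set 𝒞 of positive clauses, H ∩ M = ∅, and let G ⊆ H. Then the set of literals {¬h : h ∈ G} is an explanation for (KB, H, M) if and only if (i) no clause C ∈ 𝒞 satisfies C ⊆ G, and (ii) for every m ∈ M there is a clause C ∈ 𝒞 with m ∈ C and C ∖ {m} ⊆ G. (This is the correctness core of the reduction from ABD(k-CNF⁺) to SimpleSAT^k.) -/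
variable {V : Type*}

/-- Suppose `KB` is given by a finite set `𝒞` of positive clauses,
`H ∩ M = ∅`, and `G ⊆ H`.  Then `{¬h : h ∈ G}` is an explanation for
`(KB, H, M)` iff (i) no clause `C ∈ 𝒞` satisfies `C ⊆ G`, and (ii) for every
`m ∈ M` there is a clause `C ∈ 𝒞` with `m ∈ C` and `C \ {m} ⊆ G`. -/
theorem stmt11 [Fintype V] [DecidableEq V] (𝒞 : Finset (Finset V))
    (H M : Set V) (hHM : H ∩ M = ∅) (G : Set V) (hGH : G ⊆ H) :
    IsExpl {σ : V → Bool | ∀ C ∈ 𝒞, ∃ x ∈ C, σ x = true} H M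
        ((fun x => (x, false)) '' G) ↔
      ((∀ C ∈ 𝒞, ¬((C : Set V) ⊆ G)) ∧
        ∀ m ∈ M, ∃ C ∈ 𝒞, m ∈ C ∧ (C : Set V) \ {m} ⊆ G) := by
  classical
  have satLits_iff (σ : V → Bool) :
      SatLits σ ((fun x => (x, false)) '' G) ↔ ∀ x ∈ G, σ x = false := by
    simp [SatLits]
  simp only [IsExpl, satLits_iff, Set.mem_ofPred_eq]
  constructor
  · rintro ⟨-, ⟨σ, hσ, hσG⟩, hent⟩
    have hC : ∀ C ∈ 𝒞, ¬((C : Set V) ⊆ G) := by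
      intro C hC hCG
      obtain ⟨x, hx, hxt⟩ := hσ C hC
      simp [hσG x (hCG hx)] at hxt
    refine ⟨hC, fun m hm => ?_⟩
    by_contra! hno
    -- The assignment false exactly on `G ∪ {m}` is a model of the clauses refuting `m`.
    have hmt := hent (fun x => decide (¬(x ∈ G ∨ x = m))) ?_ ?_ m hm
    · simp at hmt
    · intro C hCC
      by_contra! hfalse
      have hsub : ∀ x ∈ C, x ∈ G ∨ x = m := fun x hx => by
        simpa [or_iff_not_imp_left] using hfalse x hx
      by_cases hmC : m ∈ C
      · exact hno C hCC hmC fun x hx => (hsub x hx.1).resolve_right hx.2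
      · exact hC C hCC fun x hx =>
          (hsub x hx).resolve_right fun h => hmC (h ▸ hx)
    · intro x hx
      simp [hx]
  · rintro ⟨hC, hM⟩
    refine ⟨?_, ⟨fun x => decide (x ∉ G), ?_, ?_⟩, ?_⟩
    · rintro _ ⟨x, hx, rfl⟩
      exact hGH hx
    · intro C hCC
      obtain ⟨x, hx, hxG⟩ := Set.not_subset.mp (hC C hCC)
      exact ⟨x, hx, by simpa using hxG⟩
    · intro x hx
      simpa using hx
    · intro σ hσ hσG m hm
      obtain ⟨C, hCC, -, hsub⟩ := hM m hm
      obtain ⟨x, hx, hxt⟩ := hσ C hCC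
      by_cases hxm : x = m
      · exact hxm ▸ hxt
      · simp [hσG x (hsub ⟨hx, hxm⟩)] at hxt
end

section
/- Let X and Y be disjoint finite sets of variables, let s be a fresh variable not in X ∪ Y, let V = X ∪ Y ∪ {s}, and let Φ be an arbitrary set of assignments X ∪ Y → Bool. Define KB over V as the set of all assignments τ : V → Bool such that (if the restriction of τ to X ∪ Y lies in Φ, then τ(s) = true and τ(y) = true for every y ∈ Y) and (if τ(s) = true then τ(y) = true for every y ∈ Y). Then there exists α : X → Bool such that for every β : Y → Bool the combined assignment of α and β lies in Φ, if and only if the abduction instance (KB, X, Y ∪ {s}) has an explanation. (Correctness of the reduction from the quantified Boolean problem ∃X∀Y Φ, with Φ in 3-DNF in the paper, to ABD(4-CNF), underlying the SETH lower bound.) -/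
variable {V : Type*}

open Classical in
/-- Correctness of the reduction from `∃X∀Y Φ` to abduction: with
`KB = {τ | (τ|_{X∪Y} ∈ Φ → τ(s) ∧ ∀ y ∈ Y, τ(y)) ∧ (τ(s) → ∀ y ∈ Y, τ(y))}`,
there exists `α : X → Bool` such that for all `β : Y → Bool` the combined
assignment lies in `Φ`, iff `(KB, X, Y ∪ {s})` has an explanation. -/
theorem stmt12 [Fintype V] (X Y : Set V) (s : V)
    (hXY : Disjoint X Y) (hs : s ∉ X ∪ Y)
    (Φ : Set (↥(X ∪ Y) → Bool)) :
    (∃ α : ↥X → Bool, ∀ β : ↥Y → Bool,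
        (fun z : ↥(X ∪ Y) =>
          if h : (z : V) ∈ X then α ⟨z, h⟩
          else β ⟨z, ((Set.mem_union _ _ _).mp z.2).resolve_left h⟩) ∈ Φ) ↔
      ∃ E, IsExpl
        {τ : V → Bool |
          ((fun z : ↥(X ∪ Y) => τ ↑z) ∈ Φ → τ s = true ∧ ∀ y ∈ Y, τ y = true) ∧
            (τ s = true → ∀ y ∈ Y, τ y = true)}
        X (Y ∪ {s}) E := by
  constructor
  · rintro ⟨α, hα⟩
    refine ⟨{l | ∃ h : l.1 ∈ X, l.2 = α ⟨l.1, h⟩}, fun l hl => hl.1,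
      ⟨fun v => if h : v ∈ X then α ⟨v, h⟩ else true, ?_, ?_⟩, ?_⟩
    · have hsX : s ∉ X := fun h => hs (Or.inl h)
      have hY : ∀ y ∈ Y, (if h : y ∈ X then α ⟨y, h⟩ else true) = true :=
        fun y hy => dif_neg (Set.disjoint_right.mp hXY hy)
      exact ⟨fun _ => ⟨dif_neg hsX, hY⟩, fun _ => hY⟩
    · rintro ⟨v, b⟩ ⟨h, hb⟩
      exact (dif_pos h).trans hb.symm
    · rintro τ ⟨hτ, -⟩ hE m hm
      have hΦ : (fun z : ↥(X ∪ Y) => τ ↑z) ∈ Φ := by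
        convert hα fun y => τ y using 2 with z
        split_ifs with h
        · exact hE (z, α ⟨z, h⟩) ⟨h, rfl⟩
        · rfl
      rcases hm with hm | rfl
      · exact (hτ hΦ).2 m hm
      · exact (hτ hΦ).1
  · rintro ⟨E, hEX, ⟨σ, -, hσ⟩, hent⟩
    refine ⟨fun x => σ x, fun β => ?_⟩
    by_contra hβ
    let τ : V → Bool := fun v =>
      if v ∈ X then σ v else if h : v ∈ Y then β ⟨v, h⟩ else false
    have hτs : τ s = false := by
      rw [Set.mem_union, not_or] at hs
      simp [τ, hs.1, hs.2]
    have hτΦ : (fun z : ↥(X ∪ Y) => τ ↑z) ∉ Φ := by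
      convert hβ using 3 with z
      by_cases h : (z : V) ∈ X
      · simp [τ, h]
      · simp [τ, h, z.2.resolve_left h]
    have hτE : SatLits τ E := fun l hl => (if_pos (hEX l hl)).trans (hσ l hl)
    have hs_true : τ s = true :=
      hent τ ⟨fun h => absurd h hτΦ, fun h => by simp [hτs] at h⟩ hτE s (Or.inr rfl)
    simp [hτs] at hs_true
end

section
/- Let k ≥ 1 and let R ⊆ (Fin k → Bool) be a nonempty Boolean relation that is closed under componentwise negation (t ∈ R implies the tuple i ↦ ¬t(i) is in R) and contains neither the all-false nor the all-true tuple. Then for every t ∈ R, the binary relation S = {(a, b) ∈ Bool × Bool : the tuple assigning a to every coordinate i with t(i) = false and b to every coordinate i with t(i) = true lies in R} equals exactly {(false, true), (true, false)}, the binary disequality relation. (Key step showing that R_{≠} is qfpp-definable from any constraint language whose polymorphisms are exactly the projections and negated projections.) -/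
/-- Let `R` be a nonempty `k`-ary Boolean relation (`k ≥ 1`) closed under
componentwise negation and containing neither the all-false nor the all-true
tuple.  Then for every `t ∈ R`, the binary relation obtained by identifying
the coordinates where `t` is false to a variable `a` and the coordinates
where `t` is true to a variable `b` is exactly the disequality relation
`{(false, true), (true, false)}`. -/
theorem stmt14 (k : ℕ) (hk : 1 ≤ k) (R : Set (Fin k → Bool))
    (hne : R.Nonempty)
    (hneg : ∀ t ∈ R, (fun i => !t i) ∈ R)
    (hf : (fun _ => false) ∉ R) (ht : (fun _ => true) ∉ R) :
    ∀ t ∈ R,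
      {p : Bool × Bool | (fun i => if t i then p.2 else p.1) ∈ R} =
        {(false, true), (true, false)} := by
  intro t htR
  have h_id : (fun i => if t i then true else false) = t := by
    funext i; cases t i <;> rfl
  have h_neg : (fun i => if t i then false else true) = fun i => !t i := by
    funext i; cases t i <;> rfl
  ext ⟨a, b⟩
  cases a <;> cases b
  · simpa using hf
  · simpa [h_id] using htR
  · simpa [h_neg] using hneg t htR
  · simpa using ht
end

section
/- Let Θ be a set of assignments V → Bool over a finite variable set V, let A, B ⊆ V, and let v₀, v₁ be two distinct fresh variables not in V. Let φ be the knowledge base over V whose models are the σ ∈ Θ with σ(x) = false for every x ∈ A and σ(y) = true for every y ∈ B. Let φ′ be the knowledge base over V ∪ {v₀, v₁} whose models are the assignments τ such that the restriction of τ to V lies in Θ, τ(x) = ¬τ(v₁) for every x ∈ A, τ(y) = ¬τ(v₀) for every y ∈ B, and τ(v₀) = ¬τ(v₁). Then for all H, M ⊆ V, the instance (φ, H, M) has a positive explanation if and only if (φ′, H ∪ {v₁}, M ∪ {v₁}) has a positive explanation. (Correctness of the construction eliminating the constant relations ⊥, ⊤ for complementative languages.) -/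
variable {V : Type*}

/-- `E ⊆ H` is a positive explanation for the abduction instance `(KB, H, M)`:
`KB ∧ E` is satisfiable and `KB ∧ E ⊨ M`. -/
def IsPosExpl {W : Type*} (KB : Set (W → Bool)) (H M : Set W)
    (E : Set W) : Prop :=
  E ⊆ H ∧ (∃ σ ∈ KB, ∀ x ∈ E, σ x = true) ∧
    ∀ σ ∈ KB, (∀ x ∈ E, σ x = true) → ∀ m ∈ M, σ m = true

/-- Correctness of the construction eliminating the constant relations
`⊥, ⊤` for complementative languages.  The fresh variables `v₀, v₁` are
modelled as `Sum.inr false` and `Sum.inr true`.  The instance `(φ, H, M)`,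
where `φ` consists of the `σ ∈ Θ` that are false on `A` and true on `B`,
has a positive explanation iff `(φ', H ∪ {v₁}, M ∪ {v₁})` has one, where
`φ'` replaces the constants by disequalities with `v₀` and `v₁`. -/
theorem stmt15 [Fintype V] (Θ : Set (V → Bool)) (A B H M : Set V) :
    (∃ E, IsPosExpl
        {σ : V → Bool | σ ∈ Θ ∧ (∀ x ∈ A, σ x = false) ∧ ∀ y ∈ B, σ y = true}
        H M E) ↔
      ∃ E, IsPosExpl
        {τ : V ⊕ Bool → Bool |
          (fun v => τ (Sum.inl v)) ∈ Θ ∧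
            (∀ x ∈ A, τ (Sum.inl x) = !τ (Sum.inr true)) ∧
            (∀ y ∈ B, τ (Sum.inl y) = !τ (Sum.inr false)) ∧
            τ (Sum.inr false) = !τ (Sum.inr true)}
        (Sum.inl '' H ∪ {Sum.inr true}) (Sum.inl '' M ∪ {Sum.inr true}) E := by
  constructor
  · rintro ⟨E, hEH, ⟨σ, ⟨hΘ, hA, hB⟩, hσE⟩, hM⟩
    refine ⟨Sum.inl '' E ∪ {Sum.inr true}, Set.union_subset_union_left _ (Set.image_mono hEH),
      ⟨Sum.elim σ id, ⟨hΘ, by simpa using hA, by simpa using hB, rfl⟩, ?_⟩, ?_⟩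
    · rintro _ (⟨x, hx, rfl⟩ | rfl)
      · exact hσE x hx
      · rfl
    · rintro τ ⟨hτΘ, hτA, hτB, hτ⟩ hτE
      have h₁ : τ (Sum.inr true) = true := hτE _ (Or.inr rfl)
      have h₀ : τ (Sum.inr false) = false := by rw [hτ, h₁]; rfl
      rintro _ (⟨m, hm, rfl⟩ | rfl)
      · refine hM (fun v => τ (Sum.inl v)) ⟨hτΘ, fun x hx => ?_, fun y hy => ?_⟩
          (fun x hx => hτE _ (Or.inl ⟨x, hx, rfl⟩)) m hm
        · simp [hτA x hx, h₁]
        · simp [hτB y hy, h₀]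
      · exact h₁
  · rintro ⟨E, hEH, ⟨τ, ⟨hΘ, hA, hB, hτ⟩, hτE⟩, hM⟩
    have h₁ : τ (Sum.inr true) = true := hM τ ⟨hΘ, hA, hB, hτ⟩ hτE _ (Or.inr rfl)
    have h₀ : τ (Sum.inr false) = false := by rw [hτ, h₁]; rfl
    refine ⟨Sum.inl ⁻¹' E, ?_, ⟨fun v => τ (Sum.inl v), ⟨hΘ, fun x hx => ?_, fun y hy => ?_⟩,
      fun x hx => hτE _ hx⟩, ?_⟩
    · intro x hx
      simpa using hEH hx
    · simp [hA x hx, h₁]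
    · simp [hB y hy, h₀]
    · rintro σ ⟨hσΘ, hσA, hσB⟩ hσE m hm
      refine hM (Sum.elim σ id) ⟨hσΘ, by simpa using hσA, by simpa using hσB, rfl⟩ ?_
        (Sum.inl m) (Or.inl ⟨m, hm, rfl⟩)
      intro x hx
      rcases hEH hx with ⟨y, _, rfl⟩ | rfl
      · exact hσE y hx
      · rfl
end

section
/- Let φ be a CNF knowledge base over a finite variable set V, given by a finite set of clauses, each clause a finite set of literals over V, whose models are the assignments satisfying at least one literal of every clause. Let v₀, v₁ be distinct fresh variables not in V, and let φ′ be the knowledge base over V ∪ {v₀, v₁} whose models are the assignments τ such that τ(v₀) = ¬τ(v₁) and, for every clause C, it is not the case that all literals of C evaluate to false under τ and τ(v₀) = false, and it is not the case that all literals of C evaluate to true under τ and τ(v₀) = true (the not-all-equal constraint on the literals of C together with v₀). Then for all H, M ⊆ V, the instance (φ, H, M) has a positive explanation if and only if (φ′, H ∪ {v₁}, M ∪ {v₁}) has a positive explanation. (Correctness of the CV-reduction from (P-)ABD(k-CNF) to (P-)ABD((k+1)-NAE).) -/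
variable {V : Type*}

/-- Correctness of the CV-reduction from (P-)ABD(k-CNF) to
(P-)ABD((k+1)-NAE).  Clauses are finite sets of literals (pairs of a
variable and a polarity); the fresh variables `v₀, v₁` are modelled as
`Sum.inr false` and `Sum.inr true`.  The CNF instance `(φ, H, M)` has a
positive explanation iff the NAE instance
`(φ', H ∪ {v₁}, M ∪ {v₁})` has one, where `φ'` requires `v₀ ≠ v₁` and, for
every clause `C`, not-all-equal on the literal values of `C` together with
`v₀`. -/
theorem stmt16 [Fintype V] [DecidableEq V]
    (φ : Finset (Finset (V × Bool))) (H M : Set V) :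
    (∃ E, IsPosExpl
        {σ : V → Bool | ∀ C ∈ φ, ∃ l ∈ C, σ l.1 = l.2} H M E) ↔
      ∃ E, IsPosExpl
        {τ : V ⊕ Bool → Bool |
          τ (Sum.inr false) = !τ (Sum.inr true) ∧
            ∀ C ∈ φ,
              ¬((∀ l ∈ C, τ (Sum.inl l.1) ≠ l.2) ∧ τ (Sum.inr false) = false) ∧
              ¬((∀ l ∈ C, τ (Sum.inl l.1) = l.2) ∧ τ (Sum.inr false) = true)}
        (Sum.inl '' H ∪ {Sum.inr true}) (Sum.inl '' M ∪ {Sum.inr true}) E := by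
  have extend_mem : ∀ σ : V → Bool, (∀ C ∈ φ, ∃ l ∈ C, σ l.1 = l.2) →
      ∀ C ∈ φ, ¬ (∀ l ∈ C, σ l.1 ≠ l.2) := by
    intro σ hσ C hC hall
    obtain ⟨l, hl, h⟩ := hσ C hC
    exact hall l hl h
  have restrict_mem : ∀ τ : V ⊕ Bool → Bool, τ (Sum.inr false) = false →
      (∀ C ∈ φ, ¬((∀ l ∈ C, τ (Sum.inl l.1) ≠ l.2) ∧ τ (Sum.inr false) = false) ∧
        ¬((∀ l ∈ C, τ (Sum.inl l.1) = l.2) ∧ τ (Sum.inr false) = true)) →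
      ∀ C ∈ φ, ∃ l ∈ C, τ (Sum.inl l.1) = l.2 := by
    intro τ h₀ hτ C hC
    by_contra! hall
    exact (hτ C hC).1 ⟨hall, h₀⟩
  constructor
  · rintro ⟨E, hEH, ⟨σ, hσ, hσE⟩, hent⟩
    refine ⟨Sum.inl '' E ∪ {Sum.inr true},
      Set.union_subset_union_left _ (Set.image_mono hEH), ⟨Sum.elim σ id, ?_, ?_⟩, ?_⟩
    · refine ⟨rfl, fun C hC => ⟨fun h => extend_mem σ hσ C hC h.1, fun h => ?_⟩⟩
      simp at h
    · rintro _ (⟨x, hx, rfl⟩ | rfl)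
      · exact hσE x hx
      · rfl
    · rintro τ ⟨hv, hτ⟩ hτE
      have h₁ : τ (Sum.inr true) = true := hτE _ (Or.inr rfl)
      have h₀ : τ (Sum.inr false) = false := by rw [hv, h₁]; rfl
      rintro _ (⟨m, hm, rfl⟩ | rfl)
      · exact hent (fun x => τ (Sum.inl x)) (restrict_mem τ h₀ hτ)
          (fun x hx => hτE _ (Or.inl ⟨x, hx, rfl⟩)) m hm
      · exact h₁
  · rintro ⟨E, hEH, ⟨τ, ⟨hv, hτ⟩, hτE⟩, hent⟩
    have h₁ : τ (Sum.inr true) = true := hent τ ⟨hv, hτ⟩ hτE _ (Or.inr rfl)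
    have h₀ : τ (Sum.inr false) = false := by rw [hv, h₁]; rfl
    refine ⟨Sum.inl ⁻¹' E, ?_, ⟨fun x => τ (Sum.inl x), restrict_mem τ h₀ hτ,
      fun x hx => hτE _ hx⟩, ?_⟩
    · intro x hx
      simpa using hEH hx
    · intro σ hσ hσE m hm
      refine hent (Sum.elim σ id) ⟨rfl, fun C hC =>
        ⟨fun h => extend_mem σ hσ C hC h.1, fun h => ?_⟩⟩ ?_ _ (Or.inl ⟨m, hm, rfl⟩)
      · simp at h
      · intro x hx
        rcases hEH hx with ⟨y, -, rfl⟩ | rfl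
        · exact hσE y hx
        · rfl
end
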